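/- arXiv:2011.10985 — 2 statements merged into one kernel-verified Lean document; each statement's English description precedes it below -/
import Mathlib

section
/- Let d ≥ 1, let h : ℝ^d → ℝ be 1-Lipschitz, and for t > 0 define the Gaussian smoothing P_t h(x) = (2πt)^{−d/2} ∫_{ℝ^d} e^{−|y−x|²/(2t)} h(y) dy. Then P_t h is twice continuously differentiable and for all x, v ∈ ℝ^d, |Δ(P_t h)(x+v) − Δ(P_t h)(x)| ≤ (2d/t) |v|, where Δ denotes the Laplacian (trace of the Hessian). -/
open MeasureTheory

/-- Gaussian smoothing `P_t h(x) = (2πt)^{−d/2} ∫ e^{−|y−x|²/(2t)} h(y) dy`. -/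
noncomputable def gaussSmooth (d : ℕ) (t : ℝ) (h : EuclideanSpace ℝ (Fin d) → ℝ)
    (x : EuclideanSpace ℝ (Fin d)) : ℝ :=
  (2 * Real.pi * t) ^ (-(d : ℝ) / 2) * ∫ y, Real.exp (-‖y - x‖ ^ 2 / (2 * t)) * h y

/-- The Laplacian of `f : ℝ^d → ℝ`, i.e. the trace of the Hessian:
`Δf(x) = Σ_i ∇_{e_i}∇_{e_i} f(x)`. -/
noncomputable def laplacian (d : ℕ) (f : EuclideanSpace ℝ (Fin d) → ℝ)
    (x : EuclideanSpace ℝ (Fin d)) : ℝ :=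
  ∑ i : Fin d, fderiv ℝ (fun y => fderiv ℝ f y (EuclideanSpace.single i 1)) x
    (EuclideanSpace.single i 1)

set_option maxSynthPendingDepth 3

theorem gs_integrable_exp {E : Type*} [NormedAddCommGroup E] [InnerProductSpace ℝ E]
    [FiniteDimensional ℝ E] [MeasurableSpace E] [BorelSpace E] {b : ℝ} (hb : 0 < b) :
    Integrable (fun z : E => Real.exp (-b * ‖z‖ ^ 2)) := by
  have h := (GaussianFourier.integrable_cexp_neg_mul_sq_norm_add (V := E) (b := (b : ℂ))
    (by simpa using hb) 0 0).norm
  refine h.congr (Filter.Eventually.of_forall fun z => ?_)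
  simp only [Complex.norm_exp]
  congr 1
  have : (-(b : ℂ) * (‖z‖ : ℂ) ^ 2 + 0 * ((inner ℝ (0 : E) z : ℝ) : ℂ))
      = ((-b * ‖z‖ ^ 2 : ℝ) : ℂ) := by push_cast; ring
  rw [this, Complex.ofReal_re]

theorem gs_dom {E : Type*} [NormedAddCommGroup E] [InnerProductSpace ℝ E]
    [FiniteDimensional ℝ E] [MeasurableSpace E] [BorelSpace E] {a : ℝ} (ha : 0 < a)
    {h : E → ℝ} (hLip : LipschitzWith 1 h) (x₀ : E) :
    ∃ g : E → ℝ, Integrable g ∧ ∀ y, ∀ x ∈ Metric.ball x₀ 1,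
      |h y| * Real.exp (-a * ‖x - y‖ ^ 2) ≤ g y := by
  refine ⟨fun y => ((|h x₀| + (1 + 4 / a)) * Real.exp a) *
    Real.exp (-(a / 4) * ‖x₀ - y‖ ^ 2), ?_, ?_⟩
  · exact ((gs_integrable_exp (E := E) (by positivity : 0 < a / 4)).comp_sub_left x₀).const_mul _
  · intro y x hx
    have hxx : ‖x - x₀‖ < 1 := by simpa [dist_eq_norm] using hx
    have h1 : |h y| ≤ |h x₀| + ‖x₀ - y‖ := by
      have := hLip.dist_le_mul x₀ y
      rw [Real.dist_eq, dist_eq_norm] at this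
      have h2 := abs_sub_abs_le_abs_sub (h y) (h x₀)
      rw [abs_sub_comm] at h2
      simp at this
      linarith
    set n := ‖x₀ - y‖ with hn
    have hn0 : 0 ≤ n := norm_nonneg _
    have h3 : 1 ≤ Real.exp (a / 4 * n ^ 2) := Real.one_le_exp (by positivity)
    have h4 : n ^ 2 ≤ 4 / a * Real.exp (a / 4 * n ^ 2) := by
      have := Real.add_one_le_exp (a / 4 * n ^ 2)
      calc n ^ 2 = 4 / a * (a / 4 * n ^ 2) := by field_simp
        _ ≤ _ := by gcongr; linarith
    have h5 : |h y| ≤ (|h x₀| + (1 + 4 / a)) * Real.exp (a / 4 * n ^ 2) := by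
      have : n ≤ 1 + n ^ 2 := by nlinarith [sq_nonneg (n - 1)]
      nlinarith [abs_nonneg (h x₀), mul_le_mul_of_nonneg_left h3 (abs_nonneg (h x₀))]
    have h6 : n ≤ ‖x - y‖ + 1 := by
      have : x₀ - y = (x - y) - (x - x₀) := by abel
      rw [hn, this]
      exact (norm_sub_le _ _).trans (by linarith)
    have h7 : n ^ 2 ≤ 2 * ‖x - y‖ ^ 2 + 2 := by
      nlinarith [sq_nonneg (‖x - y‖ - 1), norm_nonneg (x - y)]
    have h8 : Real.exp (-a * ‖x - y‖ ^ 2) ≤ Real.exp (a + -(a / 2) * n ^ 2) := by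
      apply Real.exp_le_exp.2
      nlinarith
    calc |h y| * Real.exp (-a * ‖x - y‖ ^ 2)
        ≤ ((|h x₀| + (1 + 4 / a)) * Real.exp (a / 4 * n ^ 2)) *
          Real.exp (a + -(a / 2) * n ^ 2) := by gcongr
      _ = (|h x₀| + (1 + 4 / a)) * (Real.exp (a / 4 * n ^ 2) *
          Real.exp (a + -(a / 2) * n ^ 2)) := by ring
      _ = _ := by
        simp only []
        rw [← Real.exp_add, mul_assoc, ← Real.exp_add]
        congr 2
        ring

theorem gs_integrable {E F : Type*} [NormedAddCommGroup E] [InnerProductSpace ℝ E]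
    [FiniteDimensional ℝ E] [MeasurableSpace E] [BorelSpace E]
    [NormedAddCommGroup F] [NormedSpace ℝ F] {a C : ℝ} (ha : 0 < a) (hC : 0 ≤ C)
    {h : E → ℝ} (hLip : LipschitzWith 1 h) {K : E → F} (hK : Continuous K)
    (hKb : ∀ z, ‖K z‖ ≤ C * Real.exp (-a * ‖z‖ ^ 2)) (x₀ : E) :
    Integrable (fun y => h y • K (x₀ - y)) := by
  obtain ⟨g, hg, hgb⟩ := gs_dom ha hLip x₀
  have hc := hLip.continuous
  refine (hg.const_mul C).mono' (by fun_prop : Continuous _).aestronglyMeasurable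
    (Filter.Eventually.of_forall fun y => ?_)
  rw [norm_smul, Real.norm_eq_abs]
  calc _ ≤ |h y| * (C * Real.exp (-a * ‖x₀ - y‖ ^ 2)) := by gcongr; exact hKb _
    _ = C * (|h y| * Real.exp (-a * ‖x₀ - y‖ ^ 2)) := by ring
    _ ≤ _ := by gcongr; exact hgb y x₀ (by simp)

theorem gs_continuous {E F : Type*} [NormedAddCommGroup E] [InnerProductSpace ℝ E]
    [FiniteDimensional ℝ E] [MeasurableSpace E] [BorelSpace E]
    [NormedAddCommGroup F] [NormedSpace ℝ F] {a C : ℝ} (ha : 0 < a) (hC : 0 ≤ C)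
    {h : E → ℝ} (hLip : LipschitzWith 1 h) {K : E → F} (hK : Continuous K)
    (hKb : ∀ z, ‖K z‖ ≤ C * Real.exp (-a * ‖z‖ ^ 2)) :
    Continuous (fun x => ∫ y, h y • K (x - y)) := by
  rw [continuous_iff_continuousAt]
  intro x₀
  obtain ⟨g, hg, hgb⟩ := gs_dom ha hLip x₀
  have hc := hLip.continuous
  refine continuousAt_of_dominated (bound := fun y => C * g y)
    (Filter.Eventually.of_forall fun x => (by fun_prop : Continuous _).aestronglyMeasurable)
    ?_ (hg.const_mul C)
    (Filter.Eventually.of_forall fun y => (by fun_prop : Continuous _).continuousAt)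
  filter_upwards [Metric.ball_mem_nhds x₀ one_pos] with x hx
  refine Filter.Eventually.of_forall fun y => ?_
  rw [norm_smul, Real.norm_eq_abs]
  calc _ ≤ |h y| * (C * Real.exp (-a * ‖x - y‖ ^ 2)) := by gcongr; exact hKb _
    _ = C * (|h y| * Real.exp (-a * ‖x - y‖ ^ 2)) := by ring
    _ ≤ _ := by gcongr; exact hgb y x hx

theorem gs_hasFDerivAt {E F : Type*} [NormedAddCommGroup E] [InnerProductSpace ℝ E]
    [FiniteDimensional ℝ E] [MeasurableSpace E] [BorelSpace E]
    [NormedAddCommGroup F] [NormedSpace ℝ F] {a C : ℝ} (ha : 0 < a) (hC : 0 ≤ C)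
    {h : E → ℝ} (hLip : LipschitzWith 1 h) {K : E → F} {K' : E → E →L[ℝ] F}
    (hK : ∀ z, HasFDerivAt K (K' z) z) (hK' : Continuous K')
    (hKb : ∀ z, ‖K z‖ ≤ C * Real.exp (-a * ‖z‖ ^ 2))
    (hKb' : ∀ z, ‖K' z‖ ≤ C * Real.exp (-a * ‖z‖ ^ 2)) (x₀ : E) :
    HasFDerivAt (fun x => ∫ y, h y • K (x - y)) (∫ y, h y • K' (x₀ - y)) x₀ := by
  obtain ⟨g, hg, hgb⟩ := gs_dom ha hLip x₀
  have hc := hLip.continuous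
  have hKc : Continuous K := continuous_iff_continuousAt.2 fun z => (hK z).continuousAt
  refine hasFDerivAt_integral_of_dominated_of_fderiv_le (bound := fun y => C * g y)
    (F' := fun x y => h y • K' (x - y)) (s := Metric.ball x₀ 1)
    (Metric.ball_mem_nhds x₀ one_pos)
    (Filter.Eventually.of_forall fun x => (by fun_prop : Continuous _).aestronglyMeasurable)
    (gs_integrable ha hC hLip hKc hKb x₀)
    (gs_integrable ha hC hLip hK' hKb' x₀).aestronglyMeasurable
    (Filter.Eventually.of_forall fun y x hx => ?_) (hg.const_mul C)
    (Filter.Eventually.of_forall fun y x hx => ?_)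
  · rw [norm_smul, Real.norm_eq_abs]
    calc _ ≤ |h y| * (C * Real.exp (-a * ‖x - y‖ ^ 2)) := by gcongr; exact hKb' _
      _ = C * (|h y| * Real.exp (-a * ‖x - y‖ ^ 2)) := by ring
      _ ≤ _ := by gcongr; exact hgb y x hx
  · have := (hK (x - y)).comp x ((hasFDerivAt_id x).sub_const y)
    exact this.const_smul (h y)

noncomputable def gsJ {E : Type*} [NormedAddCommGroup E] [InnerProductSpace ℝ E] :
    E →L[ℝ] E →L[ℝ] ℝ := innerSL ℝ

theorem gsJ_apply {E : Type*} [NormedAddCommGroup E] [InnerProductSpace ℝ E] (x y : E) :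
    gsJ x y = inner ℝ x y := rfl

theorem gsJ_norm {E : Type*} [NormedAddCommGroup E] [InnerProductSpace ℝ E] (x : E) :
    ‖gsJ x‖ = ‖x‖ := innerSL_apply_norm ℝ x

noncomputable def gsK1 {E : Type*} [NormedAddCommGroup E] [InnerProductSpace ℝ E] (t : ℝ) (z : E) :
    E →L[ℝ] ℝ := (-(1 / t) * Real.exp (-‖z‖ ^ 2 / (2 * t))) • gsJ z

noncomputable def gsK2 {E : Type*} [NormedAddCommGroup E] [InnerProductSpace ℝ E] (t : ℝ) (z : E) :
    E →L[ℝ] E →L[ℝ] ℝ :=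
  (-(1 / t) * Real.exp (-‖z‖ ^ 2 / (2 * t))) • (gsJ : E →L[ℝ] E →L[ℝ] ℝ) +
    ((-(1 / t)) • gsK1 t z).smulRight (gsJ z)

theorem gsK0_deriv {E : Type*} [NormedAddCommGroup E] [InnerProductSpace ℝ E] {t : ℝ} (ht : 0 < t)
    (z : E) : HasFDerivAt (fun z : E => Real.exp (-‖z‖ ^ 2 / (2 * t))) (gsK1 t z) z := by
  have h1 := (((hasFDerivAt_id z).norm_sq.neg).mul_const ((2 * t)⁻¹)).exp
  simp only [← div_eq_mul_inv] at h1
  refine h1.congr_fderiv ?_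
  ext v
  simp [gsK1, gsJ_apply]
  field_simp

theorem gsK1_deriv {E : Type*} [NormedAddCommGroup E] [InnerProductSpace ℝ E] {t : ℝ} (ht : 0 < t)
    (z : E) : HasFDerivAt (gsK1 t : E → E →L[ℝ] ℝ) (gsK2 t z) z := by
  have h1 := ((gsK0_deriv ht z).const_mul (-(1 / t))).smul
    (gsJ : E →L[ℝ] E →L[ℝ] ℝ).hasFDerivAt
  exact h1

theorem gsK1_cont {E : Type*} [NormedAddCommGroup E] [InnerProductSpace ℝ E] (t : ℝ) :
    Continuous (gsK1 t : E → E →L[ℝ] ℝ) := by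
  have := (gsJ : E →L[ℝ] E →L[ℝ] ℝ).continuous
  unfold gsK1
  have h2 : Continuous fun z : E => -(1 / t) * Real.exp (-‖z‖ ^ 2 / (2 * t)) := by fun_prop
  exact h2.smul this

theorem gsK2_cont {E : Type*} [NormedAddCommGroup E] [InnerProductSpace ℝ E] (t : ℝ) :
    Continuous (gsK2 t : E → E →L[ℝ] E →L[ℝ] ℝ) := by
  have := (gsJ : E →L[ℝ] E →L[ℝ] ℝ).continuous
  have := gsK1_cont (E := E) t
  unfold gsK2
  have h2 : Continuous fun z : E => -(1 / t) * Real.exp (-‖z‖ ^ 2 / (2 * t)) := by fun_prop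
  refine (h2.smul continuous_const).add ?_
  exact ((ContinuousLinearMap.smulRightL ℝ E (E →L[ℝ] ℝ)).continuous.comp
    (this.const_smul (-(1 / t)))).clm_apply (gsJ : E →L[ℝ] E →L[ℝ] ℝ).continuous

theorem gs_bounds {E : Type*} [NormedAddCommGroup E] [InnerProductSpace ℝ E] {t : ℝ} (ht : 0 < t) :
    ∃ C : ℝ, 0 ≤ C ∧ ∀ z : E,
      ‖Real.exp (-‖z‖ ^ 2 / (2 * t))‖ ≤ C * Real.exp (-(1 / (4 * t)) * ‖z‖ ^ 2) ∧
      ‖gsK1 t z‖ ≤ C * Real.exp (-(1 / (4 * t)) * ‖z‖ ^ 2) ∧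
      ‖gsK2 t z‖ ≤ C * Real.exp (-(1 / (4 * t)) * ‖z‖ ^ 2) := by
  set A : ℝ := 1 + 4 * t with hA
  refine ⟨1 + (1 / t) * A + ((1 / t) + (1 / t) ^ 2 * A), by positivity, fun z => ?_⟩
  set n := ‖z‖ with hn
  have hn0 : 0 ≤ n := norm_nonneg _
  set u := Real.exp (-(1 / (4 * t)) * n ^ 2) with hu
  have hu0 : 0 < u := Real.exp_pos _
  have hu1 : u ≤ 1 := Real.exp_le_one_iff.2 (by
    have : 0 ≤ (1 / (4 * t)) * n ^ 2 := by positivity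
    linarith)
  have he : Real.exp (-n ^ 2 / (2 * t)) = u * u := by
    rw [hu, ← Real.exp_add]; congr 1; field_simp; ring
  have hsq : n ^ 2 * u ≤ 4 * t := by
    have h1 := Real.add_one_le_exp (1 / (4 * t) * n ^ 2)
    have h2 : Real.exp (1 / (4 * t) * n ^ 2) * u = 1 := by
      rw [hu, ← Real.exp_add]; simp
    have h3 : 1 / (4 * t) * n ^ 2 * u ≤ 1 := by nlinarith
    calc n ^ 2 * u = 4 * t * (1 / (4 * t) * n ^ 2 * u) := by field_simp
      _ ≤ 4 * t * 1 := by gcongr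
      _ = _ := by ring
  have hn1 : n * u ≤ A := by
    have : n ≤ 1 + n ^ 2 := by nlinarith [sq_nonneg (n - 1)]
    nlinarith
  have hn2 : n * n * u ≤ A := by nlinarith
  have hit : 0 < 1 / t := by positivity
  have b0 : ‖Real.exp (-n ^ 2 / (2 * t))‖ ≤ 1 * u := by
    rw [he, Real.norm_eq_abs, abs_of_pos (by positivity)]; nlinarith
  have e1 : ‖gsK1 t z‖ = 1 / t * (u * u) * n := by
    rw [gsK1, norm_smul, gsJ_norm, ← hn, he, norm_mul, norm_neg, Real.norm_eq_abs,
      Real.norm_eq_abs, abs_of_pos hit, abs_of_pos (by positivity : 0 < u * u)]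
  have b1 : ‖gsK1 t z‖ ≤ 1 / t * A * u := by
    rw [e1]
    calc 1 / t * (u * u) * n = 1 / t * (n * u) * u := by ring
      _ ≤ _ := by gcongr
  have b2 : ‖gsK2 t z‖ ≤ (1 / t + (1 / t) ^ 2 * A) * u := by
    unfold gsK2
    refine (norm_add_le _ _).trans ?_
    rw [norm_smul, ContinuousLinearMap.norm_smulRight_apply, norm_smul, e1, gsJ_norm,
      ← hn, he, norm_mul, norm_neg, Real.norm_eq_abs,
      Real.norm_eq_abs, abs_of_pos hit, abs_of_pos (by positivity : 0 < u * u)]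
    have hI : ‖(gsJ : E →L[ℝ] E →L[ℝ] ℝ)‖ ≤ 1 := norm_innerSL_le ℝ (E := E)
    calc 1 / t * (u * u) * ‖(gsJ : E →L[ℝ] E →L[ℝ] ℝ)‖ + 1 / t * (1 / t * (u * u) * n) * n
        ≤ 1 / t * (u * 1) * 1 + (1 / t) ^ 2 * (n * n * u) * u := by
          have : 1 / t * (1 / t * (u * u) * n) * n = (1 / t) ^ 2 * (n * n * u) * u := by ring
          rw [this]
          gcongr
      _ ≤ 1 / t * (u * 1) * 1 + (1 / t) ^ 2 * A * u := by gcongr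
      _ = _ := by ring
  have p1 : 0 ≤ 1 / t * A * u := by positivity
  have p2 : 0 ≤ (1 / t + (1 / t) ^ 2 * A) * u := by positivity
  refine ⟨b0.trans ?_, b1.trans ?_, b2.trans ?_⟩ <;> nlinarith

theorem gs_eq (d : ℕ) (t : ℝ) (h : EuclideanSpace ℝ (Fin d) → ℝ) :
    gaussSmooth d t h = fun x => (2 * Real.pi * t) ^ (-(d : ℝ) / 2) *
      ∫ y, h y • Real.exp (-‖x - y‖ ^ 2 / (2 * t)) := by
  funext x
  unfold gaussSmooth
  congr 2
  funext y
  rw [norm_sub_rev, smul_eq_mul, mul_comm]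

theorem gs_d1 {d : ℕ} {t : ℝ} (ht : 0 < t) {h : EuclideanSpace ℝ (Fin d) → ℝ}
    (hLip : LipschitzWith 1 h) (x : EuclideanSpace ℝ (Fin d)) :
    HasFDerivAt (gaussSmooth d t h)
      ((2 * Real.pi * t) ^ (-(d : ℝ) / 2) • ∫ y, h y • gsK1 t (x - y)) x := by
  obtain ⟨C, hC, hb⟩ := gs_bounds (E := EuclideanSpace ℝ (Fin d)) ht
  rw [gs_eq]
  exact (gs_hasFDerivAt (by positivity : 0 < 1 / (4 * t)) hC hLip (gsK0_deriv ht) (gsK1_cont t)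
    (fun z => (hb z).1) (fun z => (hb z).2.1) x).const_mul _

theorem gs_d2 {d : ℕ} {t : ℝ} (ht : 0 < t) {h : EuclideanSpace ℝ (Fin d) → ℝ}
    (hLip : LipschitzWith 1 h) (x : EuclideanSpace ℝ (Fin d)) :
    HasFDerivAt (fun x => (2 * Real.pi * t) ^ (-(d : ℝ) / 2) • ∫ y, h y • gsK1 t (x - y))
      ((2 * Real.pi * t) ^ (-(d : ℝ) / 2) • ∫ y, h y • gsK2 t (x - y)) x := by
  obtain ⟨C, hC, hb⟩ := gs_bounds (E := EuclideanSpace ℝ (Fin d)) ht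
  exact (gs_hasFDerivAt (by positivity : 0 < 1 / (4 * t)) hC hLip (gsK1_deriv ht) (gsK2_cont t)
    (fun z => (hb z).2.1) (fun z => (hb z).2.2) x).const_smul ((2 * Real.pi * t) ^ (-(d : ℝ) / 2))

theorem gs_contDiff {d : ℕ} {t : ℝ} (ht : 0 < t) {h : EuclideanSpace ℝ (Fin d) → ℝ}
    (hLip : LipschitzWith 1 h) : ContDiff ℝ 2 (gaussSmooth d t h) := by
  obtain ⟨C, hC, hb⟩ := gs_bounds (E := EuclideanSpace ℝ (Fin d)) ht
  have h2 : (2 : WithTop ℕ∞) = ((1 : ℕ) : WithTop ℕ∞) + 1 := by norm_num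
  rw [h2, contDiff_succ_iff_hasFDerivAt]
  refine ⟨_, ?_, gs_d1 ht hLip⟩
  rw [Nat.cast_one, contDiff_one_iff_hasFDerivAt]
  refine ⟨_, ?_, gs_d2 ht hLip⟩
  exact (gs_continuous (by positivity : 0 < 1 / (4 * t)) hC hLip (gsK2_cont t)
    (fun z => (hb z).2.2)).const_smul ((2 * Real.pi * t) ^ (-(d : ℝ) / 2))

theorem gs_trace (d : ℕ) {t : ℝ} (ht : 0 < t) (z : EuclideanSpace ℝ (Fin d)) :
    ∑ i : Fin d, gsK2 t z (EuclideanSpace.single i 1) (EuclideanSpace.single i 1) =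
      Real.exp (-‖z‖ ^ 2 / (2 * t)) * (‖z‖ ^ 2 / t ^ 2 - d / t) := by
  have : ∀ i : Fin d, gsK2 t z (EuclideanSpace.single i 1) (EuclideanSpace.single i 1) =
      Real.exp (-‖z‖ ^ 2 / (2 * t)) * ((z i) ^ 2 / t ^ 2 - 1 / t) := by
    intro i
    simp [gsK2, gsK1, gsJ_apply, EuclideanSpace.inner_single_right]
    field_simp
    ring
  simp_rw [this]
  rw [← Finset.mul_sum, Finset.sum_sub_distrib, ← Finset.sum_div, EuclideanSpace.real_norm_sq_eq]
  simp
  ring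

theorem gs_laplacian {d : ℕ} {t : ℝ} (ht : 0 < t) {h : EuclideanSpace ℝ (Fin d) → ℝ}
    (hLip : LipschitzWith 1 h) (x : EuclideanSpace ℝ (Fin d)) :
    Integrable (fun z : EuclideanSpace ℝ (Fin d) => h (x - z) *
        (Real.exp (-‖z‖ ^ 2 / (2 * t)) * (‖z‖ ^ 2 / t ^ 2 - d / t))) ∧
    laplacian d (gaussSmooth d t h) x = (2 * Real.pi * t) ^ (-(d : ℝ) / 2) *
      ∫ z : EuclideanSpace ℝ (Fin d), h (x - z) *
        (Real.exp (-‖z‖ ^ 2 / (2 * t)) * (‖z‖ ^ 2 / t ^ 2 - d / t)) := by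
  obtain ⟨C, hC, hb⟩ := gs_bounds (E := EuclideanSpace ℝ (Fin d)) ht
  have hint : Integrable (fun y => h y • gsK2 t (x - y)) :=
    gs_integrable (by positivity : 0 < 1 / (4 * t)) hC hLip (gsK2_cont t)
      (fun z => (hb z).2.2) x
  have hint1 : ∀ v, Integrable (fun y => (h y • gsK2 t (x - y)) v) := fun v =>
    (ContinuousLinearMap.apply ℝ (EuclideanSpace ℝ (Fin d) →L[ℝ] ℝ) v).integrable_comp hint
  have hint2 : ∀ v w, Integrable (fun y => (h y • gsK2 t (x - y)) v w) := fun v w =>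
    (ContinuousLinearMap.apply ℝ ℝ w).integrable_comp (hint1 v)
  have key : ∀ y, ∑ i : Fin d, (h y • gsK2 t (x - y)) (EuclideanSpace.single i 1)
      (EuclideanSpace.single i 1) = h (x - (x - y)) * (Real.exp (-‖x - y‖ ^ 2 / (2 * t)) *
        (‖x - y‖ ^ 2 / t ^ 2 - d / t)) := by
    intro y
    rw [← gs_trace d ht, Finset.mul_sum, sub_sub_cancel]
    rfl
  constructor
  · have h1 : Integrable (fun y => ∑ i : Fin d, (h y • gsK2 t (x - y)) (EuclideanSpace.single i 1)
      (EuclideanSpace.single i 1)) := integrable_finsetSum _ fun i _ => hint2 _ _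
    simp_rw [key] at h1
    have h2 := h1.comp_sub_left x
    simpa only [sub_sub_cancel] using h2
  · have hf : fderiv ℝ (gaussSmooth d t h) = fun x =>
        (2 * Real.pi * t) ^ (-(d : ℝ) / 2) • ∫ y, h y • gsK1 t (x - y) :=
      funext fun x => (gs_d1 ht hLip x).fderiv
    have hl : ∀ v, fderiv ℝ (fun y => fderiv ℝ (gaussSmooth d t h) y v) x v =
        (2 * Real.pi * t) ^ (-(d : ℝ) / 2) * ∫ y, (h y • gsK2 t (x - y)) v v := by
      intro v
      rw [hf]
      have := ((ContinuousLinearMap.apply ℝ ℝ v).hasFDerivAt.comp x (gs_d2 ht hLip x)).fderiv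
      have h3 := congrArg (fun A => A v) this
      refine h3.trans ?_
      rw [← ContinuousLinearMap.integral_apply (hint1 v), ← ContinuousLinearMap.integral_apply hint]
      rfl
    unfold laplacian
    simp_rw [hl]
    rw [← Finset.mul_sum, ← integral_finsetSum _ fun i _ => hint2 _ _]
    simp_rw [key]
    rw [integral_sub_left_eq_self (fun z => h (x - z) * (Real.exp (-‖z‖ ^ 2 / (2 * t)) *
        (‖z‖ ^ 2 / t ^ 2 - d / t)))]

theorem gs_mass (d : ℕ) {t : ℝ} (ht : 0 < t) : (2 * Real.pi * t) ^ (-(d : ℝ) / 2) *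
    ∫ z : EuclideanSpace ℝ (Fin d), Real.exp (-‖z‖ ^ 2 / (2 * t)) = 1 := by
  have h1 := GaussianFourier.integral_rexp_neg_mul_sq_norm (V := EuclideanSpace ℝ (Fin d))
    (b := 1 / (2 * t)) (by positivity)
  have h2 : ∀ z : EuclideanSpace ℝ (Fin d), -‖z‖ ^ 2 / (2 * t) = -(1 / (2 * t)) * ‖z‖ ^ 2 := by
    intro z; ring
  simp_rw [h2]
  rw [h1, finrank_euclideanSpace_fin]
  have h3 : Real.pi / (1 / (2 * t)) = 2 * Real.pi * t := by field_simp
  have hp := Real.pi_pos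
  rw [h3, ← Real.rpow_add (by positivity)]
  ring_nf
  simp

theorem gs_zero (d : ℕ) {t : ℝ} (ht : 0 < t) :
    Integrable (fun z : EuclideanSpace ℝ (Fin d) =>
      (Real.exp (-‖z‖ ^ 2 / (2 * t)) * (‖z‖ ^ 2 / t ^ 2 - d / t))) ∧
    (2 * Real.pi * t) ^ (-(d : ℝ) / 2) * ∫ z : EuclideanSpace ℝ (Fin d),
      (Real.exp (-‖z‖ ^ 2 / (2 * t)) * (‖z‖ ^ 2 / t ^ 2 - d / t)) = 0 := by
  have h1 := gs_laplacian (d := d) ht (h := fun _ => 1) (LipschitzWith.const' 1) 0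
  have hc : gaussSmooth d t (fun _ => 1) = fun _ => 1 := by
    rw [gs_eq]
    funext x
    simp only [smul_eq_mul, one_mul]
    rw [integral_sub_left_eq_self (fun z => Real.exp (-‖z‖ ^ 2 / (2 * t))), gs_mass d ht]
  rw [hc] at h1
  simp only [one_mul] at h1
  refine ⟨h1.1, h1.2.symm.trans ?_⟩
  simp [laplacian]

/-- Inequality (Bp4) of Lemma 4.4: for 1-Lipschitz `h`, the Gaussian smoothing `P_t h`
is `C²` and `|Δ(P_t h)(x+v) − Δ(P_t h)(x)| ≤ (2d/t)|v|`. -/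
theorem gaussSmooth_laplacian_lipschitz
    {d : ℕ} (hd : 1 ≤ d) {t : ℝ} (ht : 0 < t)
    (h : EuclideanSpace ℝ (Fin d) → ℝ) (hLip : LipschitzWith 1 h) :
    ContDiff ℝ 2 (gaussSmooth d t h) ∧
      ∀ x v : EuclideanSpace ℝ (Fin d),
        |laplacian d (gaussSmooth d t h) (x + v) - laplacian d (gaussSmooth d t h) x| ≤
          2 * d / t * ‖v‖ := by
  refine ⟨gs_contDiff ht hLip, fun x v => ?_⟩
  obtain ⟨i1, e1⟩ := gs_laplacian ht hLip (x + v)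
  obtain ⟨i2, e2⟩ := gs_laplacian ht hLip x
  obtain ⟨i0, e0⟩ := gs_zero d ht
  have m := gs_mass d ht
  have hp := Real.pi_pos
  set c := (2 * Real.pi * t) ^ (-(d : ℝ) / 2) with hc
  have hc0 : 0 < c := by positivity
  have ie : Integrable (fun z : EuclideanSpace ℝ (Fin d) => Real.exp (-‖z‖ ^ 2 / (2 * t))) := by
    have := gs_integrable_exp (E := EuclideanSpace ℝ (Fin d)) (b := 1 / (2 * t)) (by positivity)
    refine this.congr (Filter.Eventually.of_forall fun z => ?_)
    simp only []
    congr 1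
    ring
  rw [e1, e2, ← mul_sub, ← integral_sub i1 i2, abs_mul, abs_of_pos hc0]
  have hb : |∫ z : EuclideanSpace ℝ (Fin d), (h (x + v - z) *
        (Real.exp (-‖z‖ ^ 2 / (2 * t)) * (‖z‖ ^ 2 / t ^ 2 - d / t)) - h (x - z) *
        (Real.exp (-‖z‖ ^ 2 / (2 * t)) * (‖z‖ ^ 2 / t ^ 2 - d / t)))| ≤
      ∫ z : EuclideanSpace ℝ (Fin d), ‖v‖ * (Real.exp (-‖z‖ ^ 2 / (2 * t)) *
        (‖z‖ ^ 2 / t ^ 2 - d / t) + 2 * d / t * Real.exp (-‖z‖ ^ 2 / (2 * t))) := by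
    rw [← Real.norm_eq_abs]
    refine norm_integral_le_of_norm_le ((i0.add (ie.const_mul (2 * d / t))).const_mul ‖v‖)
      (Filter.Eventually.of_forall fun z => ?_)
    have hl : |h (x + v - z) - h (x - z)| ≤ ‖v‖ := by
      have := hLip.dist_le_mul (x + v - z) (x - z)
      rw [Real.dist_eq, dist_eq_norm] at this
      have e : x + v - z - (x - z) = v := by abel
      simpa [e] using this
    rw [← sub_mul, norm_mul, norm_mul, Real.norm_eq_abs, Real.norm_eq_abs, Real.norm_eq_abs,
      Real.abs_exp]
    have hq : |‖z‖ ^ 2 / t ^ 2 - d / t| ≤ ‖z‖ ^ 2 / t ^ 2 - d / t + 2 * d / t := by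
      have p1 : 0 ≤ ‖z‖ ^ 2 / t ^ 2 := by positivity
      have p2 : 0 ≤ (d : ℝ) / t := by positivity
      have p3 : 2 * (d : ℝ) / t = 2 * (d / t) := by ring
      rw [p3, abs_le]
      constructor <;> linarith
    calc _ ≤ ‖v‖ * (Real.exp (-‖z‖ ^ 2 / (2 * t)) * (‖z‖ ^ 2 / t ^ 2 - d / t + 2 * d / t)) := by
          gcongr
      _ = _ := by ring
  refine (mul_le_mul_of_nonneg_left hb hc0.le).trans (le_of_eq ?_)
  rw [integral_const_mul, integral_add i0 (ie.const_mul _), integral_const_mul]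
  calc _ = ‖v‖ * ((c * ∫ z : EuclideanSpace ℝ (Fin d), (Real.exp (-‖z‖ ^ 2 / (2 * t)) *
        (‖z‖ ^ 2 / t ^ 2 - d / t))) + 2 * d / t * (c * ∫ z : EuclideanSpace ℝ (Fin d),
          Real.exp (-‖z‖ ^ 2 / (2 * t)))) := by ring
    _ = _ := by rw [e0, m]; ring
end

section
/- Let d ≥ 1 and α ∈ (1, 2). Let V(𝕊^{d−1}) = 2π^{d/2}/Γ(d/2), d_α = α 2^α Γ((d+α)/2) / (Γ(d/2) Γ((2−α)/2)), and σ = (α / (V(𝕊^{d−1}) d_α))^{1/α}. Let Z̃ be a random vector in ℝ^d with density p(z) = α / (V(𝕊^{d−1}) |z|^{α+d}) for |z| > 1 and p(z) = 0 for |z| ≤ 1. Then there exists a constant C depending only on α and d such that for every twice continuously differentiable f : ℝ^d → ℝ with bounded gradient and with M := sup_x ‖∇²f(x)‖_HS < ∞, every x ∈ ℝ^d and every η ∈ (0, 1], | E[ f( x + (η^{1/α}/σ) Z̃ ) ] − f(x) − η · d_α ∫_{ℝ^d} ( f(x + y) − f(x) ) / |y|^{α+d} dy | ≤ C · M · η^{2/α}.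 -/
open MeasureTheory

/-- Surface area of the unit sphere `𝕊^{d−1}`: `V(𝕊^{d−1}) = 2π^{d/2}/Γ(d/2)`. -/
noncomputable def sphereArea (d : ℕ) : ℝ :=
  2 * Real.pi ^ ((d : ℝ) / 2) / Real.Gamma ((d : ℝ) / 2)

/-- The constant `d_α = α 2^α Γ((d+α)/2)/(Γ(d/2)Γ((2−α)/2))`. -/
noncomputable def stableConst (d : ℕ) (α : ℝ) : ℝ :=
  α * (2 : ℝ) ^ α * Real.Gamma (((d : ℝ) + α) / 2) /
    (Real.Gamma ((d : ℝ) / 2) * Real.Gamma ((2 - α) / 2))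

/-- The constant `σ = (α/(V(𝕊^{d−1}) d_α))^{1/α}`. -/
noncomputable def paretoSigma (d : ℕ) (α : ℝ) : ℝ :=
  (α / (sphereArea d * stableConst d α)) ^ (1 / α)

/-- The Pareto density `p(z) = α/(V(𝕊^{d−1})|z|^{α+d})` for `|z| > 1`, `0` otherwise. -/
noncomputable def paretoDensity (d : ℕ) (α : ℝ) (z : EuclideanSpace ℝ (Fin d)) : ℝ :=
  if 1 < ‖z‖ then α / (sphereArea d * ‖z‖ ^ (α + (d : ℝ))) else 0


section helpers
open Set

lemma aux_int_outer {d : ℕ} (hd : 1 ≤ d) {s ε : ℝ} (hs : s < -(d:ℝ)) (hε : 0 < ε) :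
    IntegrableOn (fun z : EuclideanSpace ℝ (Fin d) => ‖z‖ ^ s) {z | ε ≤ ‖z‖} := by
  have : Nonempty (Fin d) := ⟨⟨0, hd⟩⟩
  have hm : MeasurableSet {z : EuclideanSpace ℝ (Fin d) | ε ≤ ‖z‖} :=
    measurableSet_le measurable_const measurable_norm
  rw [← integrable_indicator_iff hm]
  have key := (integrable_fun_norm_addHaar (volume : Measure (EuclideanSpace ℝ (Fin d)))
    (f := (Ici ε).indicator (fun t : ℝ => t ^ s))).2 ?_
  · refine key.congr (Filter.Eventually.of_forall fun z => ?_)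
    by_cases h : ε ≤ ‖z‖ <;> simp [indicator, h]
  · have h1 : IntegrableOn (fun t : ℝ => t ^ (s + d - 1)) (Ici ε) := by
      rw [integrableOn_Ici_iff_integrableOn_Ioi]
      exact integrableOn_Ioi_rpow_of_lt (by linarith) hε
    have h2 : Integrable ((Ici ε).indicator (fun t : ℝ => t ^ (s + d - 1))) :=
      (integrable_indicator_iff measurableSet_Ici).2 h1
    refine (h2.integrableOn (s := Ioi 0)).congr_fun (fun t ht => ?_) measurableSet_Ioi
    have ht : 0 < t := ht
    by_cases h : ε ≤ t
    · simp only [indicator, mem_Ici, h, if_true, finrank_euclideanSpace, Fintype.card_fin,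
        smul_eq_mul]
      rw [← Real.rpow_natCast, ← Real.rpow_add ht]
      congr 1
      push_cast [hd]
      ring
    · simp [indicator, h]

lemma aux_int_inner {d : ℕ} (hd : 1 ≤ d) {s r : ℝ} (hs : -(d:ℝ) < s) :
    IntegrableOn (fun z : EuclideanSpace ℝ (Fin d) => ‖z‖ ^ s) {z | ‖z‖ ≤ r} := by
  have : Nonempty (Fin d) := ⟨⟨0, hd⟩⟩
  have hm : MeasurableSet {z : EuclideanSpace ℝ (Fin d) | ‖z‖ ≤ r} :=
    measurableSet_le measurable_norm measurable_const
  rw [← integrable_indicator_iff hm]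
  have key := (integrable_fun_norm_addHaar (volume : Measure (EuclideanSpace ℝ (Fin d)))
    (f := (Iic r).indicator (fun t : ℝ => t ^ s))).2 ?_
  · refine key.congr (Filter.Eventually.of_forall fun z => ?_)
    by_cases h : ‖z‖ ≤ r <;> simp [indicator, h]
  · have h1 : IntegrableOn (fun t : ℝ => t ^ (s + d - 1)) (Ioc 0 (max r 0)) :=
      ((intervalIntegrable_iff_integrableOn_Ioc_of_le (le_max_right r 0)).1
        (intervalIntegral.intervalIntegrable_rpow' (by linarith)))
    have h2 : Integrable ((Ioc 0 (max r 0)).indicator (fun t : ℝ => t ^ (s + d - 1))) :=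
      (integrable_indicator_iff measurableSet_Ioc).2 h1
    refine (h2.integrableOn (s := Ioi 0)).congr_fun (fun t ht => ?_) measurableSet_Ioi
    have ht : 0 < t := ht
    by_cases h : t ≤ r
    · simp only [indicator, mem_Iic, mem_Ioc, ht, h, if_true, finrank_euclideanSpace,
        Fintype.card_fin, smul_eq_mul, le_max_iff, true_or, and_self]
      rw [← Real.rpow_natCast, ← Real.rpow_add ht]
      congr 1
      push_cast [hd]
      ring
    · simp [indicator, h, ht.not_ge]

lemma aux_sphere_pos {d : ℕ} (hd : 1 ≤ d) : 0 < sphereArea d := by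
  have h : (0:ℝ) < d := by exact_mod_cast hd
  have := Real.Gamma_pos_of_pos (s := (d:ℝ)/2) (by positivity)
  unfold sphereArea
  positivity

lemma aux_stable_pos {d : ℕ} (hd : 1 ≤ d) {α : ℝ} (hα1 : 1 < α) (hα2 : α < 2) :
    0 < stableConst d α := by
  have h : (0:ℝ) < d := by exact_mod_cast hd
  have h1 := Real.Gamma_pos_of_pos (s := (d:ℝ)/2) (by positivity)
  have h2 := Real.Gamma_pos_of_pos (s := ((d:ℝ)+α)/2) (by positivity)
  have h3 := Real.Gamma_pos_of_pos (s := (2-α)/2) (by linarith)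
  unfold stableConst
  positivity

lemma aux_density_eq {d : ℕ} (α : ℝ) (z : EuclideanSpace ℝ (Fin d)) :
    paretoDensity d α z = α / sphereArea d *
      {z : EuclideanSpace ℝ (Fin d) | 1 < ‖z‖}.indicator (fun z => ‖z‖ ^ (-(α + d))) z := by
  unfold paretoDensity
  by_cases h : 1 < ‖z‖
  · simp only [h, if_true, indicator, mem_ofPred_eq]
    rw [Real.rpow_neg (norm_nonneg _), div_mul_eq_div_div]; rfl
  · simp [h, indicator]

lemma aux_density_integral {d : ℕ} (hd : 1 ≤ d) {α : ℝ} (hα1 : 1 < α) :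
    ∫ z, paretoDensity d α z = 1 := by
  have : Nonempty (Fin d) := ⟨⟨0, hd⟩⟩
  have hV := aux_sphere_pos hd
  have hd0 : (0:ℝ) < d := by exact_mod_cast hd
  simp_rw [aux_density_eq]
  rw [integral_const_mul]
  have e : ∀ z : EuclideanSpace ℝ (Fin d),
      {z : EuclideanSpace ℝ (Fin d) | 1 < ‖z‖}.indicator (fun z => ‖z‖ ^ (-(α + d))) z
      = (fun t : ℝ => (Ioi 1).indicator (fun t : ℝ => t ^ (-(α + d))) t) ‖z‖ := by
    intro z
    by_cases h : 1 < ‖z‖ <;> simp [indicator, h]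
  simp_rw [e]
  rw [integral_fun_norm_addHaar]
  have e2 : ∫ y in Ioi (0 : ℝ), y ^ (Module.finrank ℝ (EuclideanSpace ℝ (Fin d)) - 1) •
      (Ioi 1).indicator (fun t : ℝ => t ^ (-(α + d))) y = 1 / α := by
    have : ∀ y ∈ Ioi (0:ℝ), y ^ (Module.finrank ℝ (EuclideanSpace ℝ (Fin d)) - 1) •
      (Ioi 1).indicator (fun t : ℝ => t ^ (-(α + d))) y
      = (Ioi 1).indicator (fun t : ℝ => t ^ (-α - 1)) y := by
      intro y hy
      have hy : 0 < y := hy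
      by_cases h : 1 < y
      · simp only [indicator, mem_Ioi, h, if_true, finrank_euclideanSpace, Fintype.card_fin,
          smul_eq_mul]
        rw [← Real.rpow_natCast, ← Real.rpow_add hy]
        congr 1
        push_cast [hd]
        ring
      · simp [indicator, h]
    rw [setIntegral_congr_fun measurableSet_Ioi this, setIntegral_indicator measurableSet_Ioi,
      inter_eq_self_of_subset_right (Ioi_subset_Ioi zero_le_one),
      integral_Ioi_rpow_of_lt (by linarith) one_pos]
    simp
  rw [e2, measureReal_def, EuclideanSpace.volume_ball]
  have hG := Real.Gamma_pos_of_pos (s := (d:ℝ)/2) (by positivity)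
  have hG2 := Real.Gamma_pos_of_pos (s := (d:ℝ)/2+1) (by positivity)
  rw [ENNReal.toReal_mul, ENNReal.toReal_ofReal (by simp; positivity)]
  simp only [ENNReal.ofReal_one, one_pow, ENNReal.toReal_one, one_mul, Fintype.card_fin,
    finrank_euclideanSpace, smul_eq_mul, nsmul_eq_mul]
  rw [Real.Gamma_add_one (by positivity), sphereArea, Real.sqrt_eq_rpow, ← Real.rpow_natCast,
    ← Real.rpow_mul Real.pi_pos.le, show (1:ℝ) / 2 * d = d / 2 by ring]
  have := Real.rpow_pos_of_pos Real.pi_pos ((d:ℝ)/2)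
  field_simp

lemma aux_inner_scale {d : ℕ} {r s : ℝ} (hr : 0 < r) :
    ∫ z in {z : EuclideanSpace ℝ (Fin d) | ‖z‖ ≤ r}, ‖z‖ ^ s
      = r ^ (s + d) * ∫ z in {z : EuclideanSpace ℝ (Fin d) | ‖z‖ ≤ 1}, ‖z‖ ^ s := by
  have hm : ∀ r : ℝ, MeasurableSet {z : EuclideanSpace ℝ (Fin d) | ‖z‖ ≤ r} := fun r =>
    measurableSet_le measurable_norm measurable_const
  rw [← integral_indicator (hm r), ← integral_indicator (hm 1)]
  have h := Measure.integral_comp_smul (volume : Measure (EuclideanSpace ℝ (Fin d)))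
    ({z : EuclideanSpace ℝ (Fin d) | ‖z‖ ≤ r}.indicator (fun z => ‖z‖ ^ s)) r
  have e : ∀ z : EuclideanSpace ℝ (Fin d),
      {z : EuclideanSpace ℝ (Fin d) | ‖z‖ ≤ r}.indicator (fun z => ‖z‖ ^ s) (r • z)
      = r ^ s * {z : EuclideanSpace ℝ (Fin d) | ‖z‖ ≤ 1}.indicator (fun z => ‖z‖ ^ s) z := by
    intro z
    have hn : ‖r • z‖ = r * ‖z‖ := by rw [norm_smul, Real.norm_of_nonneg hr.le]
    have hi : r * ‖z‖ ≤ r ↔ ‖z‖ ≤ 1 := by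
      constructor <;> intro h <;> nlinarith
    simp only [indicator, mem_ofPred_eq, hn, hi]
    split_ifs
    · rw [Real.mul_rpow hr.le (norm_nonneg _)]
    · simp
  simp_rw [e] at h
  rw [integral_const_mul, finrank_euclideanSpace, Fintype.card_fin, abs_of_pos (by positivity),
    smul_eq_mul] at h
  rw [Real.rpow_add hr, Real.rpow_natCast, mul_right_comm, h]
  field_simp

/-- Change of variables for the Pareto increment. -/
lemma aux_outer_scale {d : ℕ} {r s : ℝ} (hr : 0 < r) (g : EuclideanSpace ℝ (Fin d) → ℝ) :
    ∫ z, {z : EuclideanSpace ℝ (Fin d) | 1 < ‖z‖}.indicator (fun z => ‖z‖ ^ (-(s + d))) z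
        * g (r • z)
      = r ^ s * ∫ z in {z : EuclideanSpace ℝ (Fin d) | r < ‖z‖}, g z * ‖z‖ ^ (-(s + d)) := by
  have hm : MeasurableSet {z : EuclideanSpace ℝ (Fin d) | r < ‖z‖} :=
    measurableSet_lt measurable_const measurable_norm
  rw [← integral_indicator hm]
  have h := Measure.integral_comp_smul (volume : Measure (EuclideanSpace ℝ (Fin d)))
    ({z : EuclideanSpace ℝ (Fin d) | r < ‖z‖}.indicator (fun z => g z * ‖z‖ ^ (-(s + d)))) r
  have e : ∀ z : EuclideanSpace ℝ (Fin d),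
      {z : EuclideanSpace ℝ (Fin d) | r < ‖z‖}.indicator
        (fun z => g z * ‖z‖ ^ (-(s + d))) (r • z)
      = r ^ (-(s + d)) * ({z : EuclideanSpace ℝ (Fin d) | 1 < ‖z‖}.indicator
        (fun z => ‖z‖ ^ (-(s + d))) z * g (r • z)) := by
    intro z
    have hn : ‖r • z‖ = r * ‖z‖ := by rw [norm_smul, Real.norm_of_nonneg hr.le]
    have hi : r < r * ‖z‖ ↔ 1 < ‖z‖ := by
      constructor <;> intro h <;> nlinarith
    simp only [indicator, mem_ofPred_eq, hn, hi]
    split_ifs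
    · rw [Real.mul_rpow hr.le (norm_nonneg _)]; ring
    · simp
  simp_rw [e] at h
  rw [integral_const_mul, finrank_euclideanSpace, Fintype.card_fin, abs_of_pos (by positivity),
    smul_eq_mul, Real.rpow_neg hr.le, Real.rpow_add hr, Real.rpow_natCast] at h
  have := Real.rpow_pos_of_pos hr s
  field_simp at h
  linarith

/-- Second-order bound on the derivative. -/
lemma aux_hess {d : ℕ} {f : EuclideanSpace ℝ (Fin d) → ℝ} (hf : ContDiff ℝ 2 f) {M : ℝ}
    (hM : ∀ x, Real.sqrt (∑ i, ∑ j,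
        (fderiv ℝ (fun y => fderiv ℝ f y (EuclideanSpace.single i 1)) x
          (EuclideanSpace.single j 1)) ^ 2) ≤ M) (x : EuclideanSpace ℝ (Fin d)) :
    ‖fderiv ℝ (fderiv ℝ f) x‖ ≤ (d:ℝ) ^ 2 * M := by
  have hM0 : 0 ≤ M := (Real.sqrt_nonneg _).trans (hM x)
  have hdf : DifferentiableAt ℝ (fderiv ℝ f) x :=
    (hf.fderiv_right (m := 1) (by norm_num)).differentiable (by norm_num) x
  have hent : ∀ i j, |fderiv ℝ (fderiv ℝ f) x (EuclideanSpace.single j 1)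
      (EuclideanSpace.single i 1)| ≤ M := by
    intro i j
    have e : fderiv ℝ (fun y => fderiv ℝ f y (EuclideanSpace.single i 1)) x
          (EuclideanSpace.single j 1) = fderiv ℝ (fderiv ℝ f) x (EuclideanSpace.single j 1)
      (EuclideanSpace.single i 1) := by
      rw [fderiv_clm_apply hdf (differentiableAt_const _)]
      simp
    rw [← e, ← Real.sqrt_sq_eq_abs]
    refine le_trans (Real.sqrt_le_sqrt ?_) (hM x)
    refine le_trans ?_ (Finset.single_le_sum (f := fun i => ∑ j,
        (fderiv ℝ (fun y => fderiv ℝ f y (EuclideanSpace.single i 1)) x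
          (EuclideanSpace.single j 1)) ^ 2) (fun i _ => by positivity) (Finset.mem_univ i))
    exact (Finset.single_le_sum (f := fun j => 
        (fderiv ℝ (fun y => fderiv ℝ f y (EuclideanSpace.single i 1)) x
          (EuclideanSpace.single j 1)) ^ 2) (fun i _ => by positivity) (Finset.mem_univ j))
  have hexp : ∀ v : EuclideanSpace ℝ (Fin d), v = ∑ j, v j • EuclideanSpace.single j (1:ℝ) := by
    intro v
    have := (EuclideanSpace.basisFun (Fin d) ℝ).sum_repr v
    simpa using this.symm
  refine ContinuousLinearMap.opNorm_le_bound _ (by positivity) fun v => ?_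
  refine ContinuousLinearMap.opNorm_le_bound _ (by positivity) fun w => ?_
  have : fderiv ℝ (fderiv ℝ f) x v w = ∑ j, ∑ i, v j * (w i *
      fderiv ℝ (fderiv ℝ f) x (EuclideanSpace.single j 1) (EuclideanSpace.single i 1)) := by
    conv_lhs => rw [hexp v, hexp w]
    simp [map_sum, Finset.mul_sum]
    rw [Finset.sum_comm]
    exact Finset.sum_congr rfl fun i _ => Finset.sum_congr rfl fun j _ => by ring
  rw [this]
  refine (norm_sum_le _ _).trans ?_
  refine (Finset.sum_le_sum fun j _ => norm_sum_le _ _).trans ?_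
  have hb : ∀ j ∈ (Finset.univ : Finset (Fin d)), ∑ i, ‖v j * (w i *
      fderiv ℝ (fderiv ℝ f) x (EuclideanSpace.single j 1) (EuclideanSpace.single i 1))‖
      ≤ ∑ i : Fin d, ‖v‖ * (‖w‖ * M) := by
    intro j _
    refine Finset.sum_le_sum fun i _ => ?_
    rw [norm_mul, norm_mul]
    have h1 := PiLp.norm_apply_le v j
    have h2 := PiLp.norm_apply_le w i
    have h3 := hent i j
    rw [← Real.norm_eq_abs] at h3
    gcongr
  refine (Finset.sum_le_sum hb).trans ?_
  simp
  apply le_of_eq; ring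

lemma aux_taylor {d : ℕ} {f : EuclideanSpace ℝ (Fin d) → ℝ} (hf : ContDiff ℝ 2 f) {B : ℝ}
    (hB : ∀ x, ‖fderiv ℝ (fderiv ℝ f) x‖ ≤ B) (x z : EuclideanSpace ℝ (Fin d)) :
    |f (x + z) - f x - fderiv ℝ f x z| ≤ B * ‖z‖ ^ 2 := by
  have hB0 : 0 ≤ B := le_trans (norm_nonneg (fderiv ℝ (fderiv ℝ f) x)) (hB x)
  have hdf : Differentiable ℝ (fderiv ℝ f) :=
    (hf.fderiv_right (m := 1) (by norm_num)).differentiable (by norm_num)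
  have hl : ∀ y, ‖fderiv ℝ f y - fderiv ℝ f x‖ ≤ B * ‖y - x‖ := fun y =>
    convex_univ.norm_image_sub_le_of_norm_fderiv_le (𝕜 := ℝ) (fun y _ => hdf y) (fun y _ => hB y)
      (mem_univ x) (mem_univ y)
  have := (convex_closedBall x ‖z‖).norm_image_sub_le_of_norm_fderiv_le' (𝕜 := ℝ)
    (f := f) (φ := fderiv ℝ f x) (C := B * ‖z‖) (x := x) (y := x + z)
    (fun y _ => hf.differentiable (by norm_num) y)
    (fun y hy => (hl y).trans (by
      have := mem_closedBall_iff_norm.1 hy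
      gcongr)) (by simp) (by simp)
  rw [add_sub_cancel_left, Real.norm_eq_abs] at this
  linarith

end helpers

section helpers2
open Set

lemma aux_main {d : ℕ} (hd : 1 ≤ d) {α : ℝ} (hα1 : 1 < α) (hα2 : α < 2)
    {f : EuclideanSpace ℝ (Fin d) → ℝ} (hf : ContDiff ℝ 2 f) {K : ℝ}
    (hK : ∀ x, ‖fderiv ℝ f x‖ ≤ K) {M : ℝ}
    (hT : ∀ x z, |f (x + z) - f x - fderiv ℝ f x z| ≤ (d:ℝ) ^ 2 * M * ‖z‖ ^ 2)
    (x : EuclideanSpace ℝ (Fin d)) {η : ℝ} (hη : 0 < η) :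
      ∃ L : ℝ,
        Filter.Tendsto
          (fun ε : ℝ => ∫ z in {z : EuclideanSpace ℝ (Fin d) | ε ≤ ‖z‖},
            (f (x + z) - f x) / ‖z‖ ^ (α + (d : ℝ)))
          (nhdsWithin 0 (Set.Ioi 0)) (nhds L) ∧
        |(∫ z, paretoDensity d α z * f (x + (η ^ (1 / α) / paretoSigma d α) • z)) -
            f x - η * stableConst d α * L| ≤
          (stableConst d α * (d:ℝ) ^ 2 * paretoSigma d α ^ (α - 2) *
            ∫ z in {z : EuclideanSpace ℝ (Fin d) | ‖z‖ ≤ 1}, ‖z‖ ^ (2 - α - d))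
            * M * η ^ (2 / α) := by
  have : Nonempty (Fin d) := ⟨⟨0, hd⟩⟩
  have hV := aux_sphere_pos hd
  have hS := aux_stable_pos hd hα1 hα2
  have hα0 : 0 < α := by linarith
  have hσ : 0 < paretoSigma d α := by unfold paretoSigma; positivity
  have hσα : paretoSigma d α ^ α = α / (sphereArea d * stableConst d α) := by
    unfold paretoSigma
    rw [← Real.rpow_mul (by positivity), one_div_mul_cancel hα0.ne', Real.rpow_one]
  set σ := paretoSigma d α with hσdef
  set r : ℝ := η ^ (1 / α) / σ with hr
  have hr0 : 0 < r := by positivity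
  have hrα : r ^ α = η / σ ^ α := by
    rw [hr, Real.div_rpow (by positivity) hσ.le, ← Real.rpow_mul hη.le,
      one_div_mul_cancel hα0.ne', Real.rpow_one]
  have hK0 : 0 ≤ K := le_trans (norm_nonneg (fderiv ℝ f x)) (hK x)
  have hfc : Continuous f := hf.continuous
  have hfcx : Continuous fun z => f (x + z) := by fun_prop
  set φ := fderiv ℝ f x with hφ
  let k : EuclideanSpace ℝ (Fin d) → ℝ := fun z => ‖z‖ ^ (-(α + d))
  let g : EuclideanSpace ℝ (Fin d) → ℝ := fun z => f (x + z) - f x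
  let R : EuclideanSpace ℝ (Fin d) → ℝ := fun z => f (x + z) - f x - φ z
  have hkm : Measurable k := measurable_norm.pow_const _
  have hgm : Measurable g := (hfcx.sub continuous_const).measurable
  have hφm : Measurable φ := φ.continuous.measurable
  have hRm : Measurable R := hgm.sub hφm
  have hk0 : ∀ z, 0 ≤ k z := fun z => Real.rpow_nonneg (norm_nonneg _) _
  have hgle : ∀ z, |g z| ≤ K * ‖z‖ := by
    intro z
    have := convex_univ.norm_image_sub_le_of_norm_fderiv_le (𝕜 := ℝ) (f := f) (C := K)
      (fun y _ => hf.differentiable (by norm_num) y) (fun y _ => hK y)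
      (mem_univ x) (mem_univ (x + z))
    rwa [add_sub_cancel_left, Real.norm_eq_abs] at this
  have hφle : ∀ z, |φ z| ≤ K * ‖z‖ := fun z => by
    rw [← Real.norm_eq_abs]
    exact φ.le_of_opNorm_le (hK x) z
  have hRle : ∀ z, |R z| ≤ (d:ℝ) ^ 2 * M * ‖z‖ ^ 2 := fun z => hT x z
  have hmo : ∀ ε : ℝ, MeasurableSet {z : EuclideanSpace ℝ (Fin d) | ε ≤ ‖z‖} := fun ε =>
    measurableSet_le measurable_const measurable_norm
  have hmi : ∀ ε : ℝ, MeasurableSet {z : EuclideanSpace ℝ (Fin d) | ‖z‖ ≤ ε} := fun ε =>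
    measurableSet_le measurable_norm measurable_const
  -- integrability away from zero
  have hout : ∀ h : EuclideanSpace ℝ (Fin d) → ℝ, Measurable h → (∀ z, |h z| ≤ K * ‖z‖) →
      ∀ ε : ℝ, 0 < ε → IntegrableOn (fun z => h z * k z) {z | ε ≤ ‖z‖} := by
    intro h hhm hh ε hε
    refine Integrable.mono' ((aux_int_outer hd (s := 1 - α - d) (by linarith) hε).const_mul K)
      (hhm.mul hkm).aestronglyMeasurable ?_
    refine (ae_restrict_iff' (hmo ε)).2 (Filter.Eventually.of_forall fun z hz => ?_)
    have hz : 0 < ‖z‖ := hε.trans_le hz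
    rw [norm_mul, Real.norm_eq_abs, Real.norm_of_nonneg (hk0 z),
      show (1:ℝ) - α - d = 1 + (-(α + d)) by ring, Real.rpow_add hz, Real.rpow_one, ← mul_assoc]
    exact mul_le_mul_of_nonneg_right (hh z) (hk0 z)
  have hgi := hout g hgm hgle
  have hφi := hout φ hφm hφle
  have hRi : ∀ ε : ℝ, 0 < ε → IntegrableOn (fun z => R z * k z) {z | ε ≤ ‖z‖} := by
    intro ε hε
    refine ((hgi ε hε).sub (hφi ε hε)).congr (Filter.Eventually.of_forall fun z => ?_)
    simp only [R, g, Pi.sub_apply]; ring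
  -- bound near zero
  have hbd : ∀ z, z ≠ 0 → ‖R z * k z‖ ≤ (d:ℝ) ^ 2 * M * ‖z‖ ^ (2 - α - d) := by
    intro z hz
    have hz : 0 < ‖z‖ := norm_pos_iff.2 hz
    rw [norm_mul, Real.norm_eq_abs, Real.norm_of_nonneg (hk0 z),
      show (2:ℝ) - α - d = 2 + (-(α + d)) by ring, Real.rpow_add hz, Real.rpow_two, ← mul_assoc]
    exact mul_le_mul_of_nonneg_right (hRle z) (hk0 z)
  have hne : ∀ᵐ z : EuclideanSpace ℝ (Fin d), z ≠ 0 := by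
    simp [ae_iff]
  have hinI : ∀ ρ : ℝ, IntegrableOn
      (fun z : EuclideanSpace ℝ (Fin d) => (d:ℝ) ^ 2 * M * ‖z‖ ^ (2 - α - d)) {z | ‖z‖ ≤ ρ} :=
    fun ρ => (aux_int_inner hd (s := 2 - α - d) (by linarith)).const_mul _
  have hRin : ∀ ρ : ℝ, IntegrableOn (fun z => R z * k z) {z | ‖z‖ ≤ ρ} := by
    intro ρ
    refine Integrable.mono' (hinI ρ) (hRm.mul hkm).aestronglyMeasurable ?_
    exact ae_restrict_of_ae (hne.mono hbd)
  have hRall : Integrable (fun z => R z * k z) := by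
    rw [← integrableOn_univ]
    refine ((hRin 1).union (hRi 1 one_pos)).mono_set fun z _ => ?_
    exact le_total ‖z‖ 1
  -- the odd part vanishes
  have hodd : ∀ S : Set (EuclideanSpace ℝ (Fin d)), MeasurableSet S → (∀ z, -z ∈ S ↔ z ∈ S) →
      ∫ z in S, φ z * k z = 0 := by
    intro S hSm hSs
    rw [← integral_indicator hSm]
    have h := integral_neg_eq_self (S.indicator fun z => φ z * k z) volume
    have e : ∀ z, S.indicator (fun z => φ z * k z) (-z) =
        - S.indicator (fun z => φ z * k z) z := by
      intro z
      by_cases hz : z ∈ S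
      · simp [indicator, hSs, hz, k]
      · simp [indicator, hSs, hz]
    simp_rw [e] at h
    rw [integral_neg] at h
    linarith
  have hgR : ∀ S : Set (EuclideanSpace ℝ (Fin d)), MeasurableSet S → (∀ z, -z ∈ S ↔ z ∈ S) →
      ∀ ε : ℝ, 0 < ε → S ⊆ {z | ε ≤ ‖z‖} →
      ∫ z in S, g z * k z = ∫ z in S, R z * k z := by
    intro S hSm hSs ε hε hSε
    have h1 : ∫ z in S, g z * k z = ∫ z in S, (R z * k z + φ z * k z) := by
      congr 1; ext z; simp only [R, g]; ring
    rw [h1, integral_add ((hRi ε hε).mono_set hSε) ((hφi ε hε).mono_set hSε), hodd S hSm hSs,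
      add_zero]
  refine ⟨∫ z, R z * k z, ?_, ?_⟩
  · have h1 : Filter.Tendsto (fun ε : ℝ => ∫ z,
        {z : EuclideanSpace ℝ (Fin d) | ε ≤ ‖z‖}.indicator (fun z => R z * k z) z)
        (nhdsWithin 0 (Ioi 0)) (nhds (∫ z, R z * k z)) := by
      refine tendsto_integral_filter_of_dominated_convergence (fun z => ‖R z * k z‖)
        (Filter.Eventually.of_forall fun ε =>
          ((hRm.mul hkm).indicator (hmo ε)).aestronglyMeasurable)
        (Filter.Eventually.of_forall fun ε => Filter.Eventually.of_forall fun z =>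
          norm_indicator_le_norm_self _ _) hRall.norm ?_
      filter_upwards [hne] with z hz
      have hz : 0 < ‖z‖ := norm_pos_iff.2 hz
      refine tendsto_const_nhds.congr' ?_
      filter_upwards [mem_nhdsWithin_of_mem_nhds (Iio_mem_nhds hz)] with ε hε
      have : ε ≤ ‖z‖ := le_of_lt hε
      simp [indicator, this]
    refine h1.congr' ?_
    filter_upwards [self_mem_nhdsWithin] with ε hε
    rw [integral_indicator (hmo ε), ← hgR _ (hmo ε) (fun z => by simp) ε hε subset_rfl]
    congr 1; ext z
    simp only [g, k]
    rw [Real.rpow_neg (norm_nonneg _)]; rfl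
  · have hp : Integrable (fun z => paretoDensity d α z) := by
      by_contra h
      have := integral_undef h
      rw [aux_density_integral hd hα1] at this
      norm_num at this
    have hmr : MeasurableSet {z : EuclideanSpace ℝ (Fin d) | r < ‖z‖} :=
      measurableSet_lt measurable_const measurable_norm
    have hpg : Integrable (fun z => paretoDensity d α z * g (r • z)) := by
      have h1 : Integrable ({z : EuclideanSpace ℝ (Fin d) | 1 ≤ ‖z‖}.indicator fun z =>
          ‖z‖ ^ (1 - α - d)) :=
        (integrable_indicator_iff (hmo 1)).2
          (aux_int_outer hd (s := 1 - α - d) (by linarith) one_pos)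
      refine (h1.const_mul (α / sphereArea d * (K * r))).mono'
        (hp.aestronglyMeasurable.mul
          (hgm.comp (measurable_const_smul r)).aestronglyMeasurable) ?_
      refine Filter.Eventually.of_forall fun z => ?_
      rw [aux_density_eq]
      by_cases h : 1 < ‖z‖
      · have hz : 0 < ‖z‖ := one_pos.trans h
        simp only [indicator, mem_ofPred_eq, h, h.le, if_true]
        have h2 := hgle (r • z)
        rw [norm_smul, Real.norm_of_nonneg hr0.le] at h2
        rw [norm_mul, Real.norm_of_nonneg (by positivity), Real.norm_eq_abs,
          show (1:ℝ) - α - d = 1 + (-(α + d)) by ring, Real.rpow_add hz, Real.rpow_one]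
        calc _ ≤ α / sphereArea d * ‖z‖ ^ (-(α + d)) * (K * (r * ‖z‖)) := by gcongr
          _ = _ := by ring
      · have h3 : 0 ≤ {z : EuclideanSpace ℝ (Fin d) | 1 ≤ ‖z‖}.indicator (fun z =>
          ‖z‖ ^ (1 - α - d)) z := indicator_nonneg (fun z _ => by positivity) z
        simp only [indicator, mem_ofPred_eq, h, if_false, mul_zero, zero_mul, norm_zero]
        simp only [indicator, mem_ofPred_eq] at h3
        positivity
    have hE : (∫ z, paretoDensity d α z * f (x + r • z)) - f x
        = ∫ z, paretoDensity d α z * g (r • z) := by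
      have : (fun z => paretoDensity d α z * f (x + r • z)) =
          fun z => paretoDensity d α z * g (r • z) + paretoDensity d α z * f x := by
        ext z; simp only [g]; ring
      rw [this, integral_add hpg (hp.mul_const _), integral_mul_const,
        aux_density_integral hd hα1]
      ring
    have hE2 : ∫ z, paretoDensity d α z * g (r • z)
        = η * stableConst d α * ∫ z in {z | r < ‖z‖}, R z * k z := by
      simp_rw [aux_density_eq, mul_assoc (α / sphereArea d)]
      rw [integral_const_mul, aux_outer_scale hr0 g,
        ← hgR _ hmr (fun z => by simp) r hr0 (fun z (hz : r < ‖z‖) => show r ≤ ‖z‖ from hz.le), hrα, hσα, ← mul_assoc]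
      congr 1
      field_simp
    have hsplit : (∫ z in {z | ‖z‖ ≤ r}, R z * k z) + ∫ z in {z | r < ‖z‖}, R z * k z
        = ∫ z, R z * k z := by
      have hc : {z : EuclideanSpace ℝ (Fin d) | r < ‖z‖} = {z | ‖z‖ ≤ r}ᶜ := by
        ext z; simp
      rw [hc]
      exact integral_add_compl (hmi r) hRall
    rw [hE, hE2, ← hsplit]
    have hbound : |∫ z in {z | ‖z‖ ≤ r}, R z * k z| ≤ (d:ℝ) ^ 2 * M * (r ^ (2 - α) *
        ∫ z in {z : EuclideanSpace ℝ (Fin d) | ‖z‖ ≤ 1}, ‖z‖ ^ (2 - α - d)) := by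
      have h1 := norm_integral_le_of_norm_le (hinI r)
        (ae_restrict_of_ae (s := {z : EuclideanSpace ℝ (Fin d) | ‖z‖ ≤ r}) (hne.mono hbd))
      rw [integral_const_mul, aux_inner_scale hr0, sub_add_cancel] at h1
      exact h1
    have hpow : η * r ^ (2 - α) = σ ^ (α - 2) * η ^ (2 / α) := by
      rw [hr, Real.div_rpow (by positivity) hσ.le, ← Real.rpow_mul hη.le,
        show α - 2 = -(2 - α) by ring, Real.rpow_neg hσ.le,
        show 2 / α = 1 + 1 / α * (2 - α) by field_simp; ring, Real.rpow_add hη, Real.rpow_one]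
      field_simp
    calc _ = η * stableConst d α * |∫ z in {z | ‖z‖ ≤ r}, R z * k z| := by
          rw [← abs_of_pos (show 0 < η * stableConst d α by positivity), ← abs_mul,
            ← abs_neg, abs_of_pos (show 0 < η * stableConst d α by positivity)]
          congr 1; ring
      _ ≤ η * stableConst d α * ((d:ℝ) ^ 2 * M * (r ^ (2 - α) *
        ∫ z in {z : EuclideanSpace ℝ (Fin d) | ‖z‖ ≤ 1}, ‖z‖ ^ (2 - α - d))) := by gcongr
      _ = stableConst d α * (d:ℝ) ^ 2 * (η * r ^ (2 - α)) * (∫ z in {z : EuclideanSpace ℝ (Fin d) | ‖z‖ ≤ 1}, ‖z‖ ^ (2 - α - d)) * M := by ring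
      _ = _ := by rw [hpow]; ring

end helpers2

/-- Claim from the proof of Lemma 4.7 (Appendix C): one scaled Pareto increment
reproduces the fractional Laplacian up to an error of order `η^{2/α}`:
`|E[f(x + (η^{1/α}/σ)Z̃)] − f(x) − η Δ^{α/2}f(x)| ≤ C M η^{2/α}` with `C` depending
only on `α` and `d`, where `Δ^{α/2}f(x) = d_α ∫ (f(x+y) − f(x))/|y|^{α+d} dy` is
understood as the (convergent) principal-value limit `L` and `M` bounds the
Hilbert–Schmidt norm of the Hessian of `f`. -/
theorem pareto_step_approximates_fractional_laplacian
    {d : ℕ} (hd : 1 ≤ d) {α : ℝ} (hα1 : 1 < α) (hα2 : α < 2) :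
    ∃ C : ℝ, ∀ f : EuclideanSpace ℝ (Fin d) → ℝ, ContDiff ℝ 2 f →
      (∃ K : ℝ, ∀ x, ‖fderiv ℝ f x‖ ≤ K) →
      ∀ M : ℝ,
      (∀ x, Real.sqrt (∑ i, ∑ j,
        (fderiv ℝ (fun y => fderiv ℝ f y (EuclideanSpace.single i 1)) x
          (EuclideanSpace.single j 1)) ^ 2) ≤ M) →
      ∀ (x : EuclideanSpace ℝ (Fin d)) (η : ℝ), 0 < η → η ≤ 1 →
      ∃ L : ℝ,
        Filter.Tendsto
          (fun ε : ℝ => ∫ z in {z : EuclideanSpace ℝ (Fin d) | ε ≤ ‖z‖},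
            (f (x + z) - f x) / ‖z‖ ^ (α + (d : ℝ)))
          (nhdsWithin 0 (Set.Ioi 0)) (nhds L) ∧
        |(∫ z, paretoDensity d α z * f (x + (η ^ (1 / α) / paretoSigma d α) • z)) -
            f x - η * stableConst d α * L| ≤
          C * M * η ^ (2 / α) := by
  refine ⟨stableConst d α * (d:ℝ) ^ 2 * paretoSigma d α ^ (α - 2) *
    ∫ z in {z : EuclideanSpace ℝ (Fin d) | ‖z‖ ≤ 1}, ‖z‖ ^ (2 - α - d), ?_⟩
  intro f hf ⟨K, hK⟩ M hM x η hη _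
  exact aux_main hd hα1 hα2 hf hK (aux_taylor hf (aux_hess hf hM)) x hη
end
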